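/- arXiv:2009.08964 — 2 statements merged into one kernel-verified Lean document; each statement's English description precedes it below -/
import Mathlib

section
/- If p > q > 0 are relatively prime integers, then len(p/q) + len(p/(p−q)) = V(p/q) + 1. -/
/-- Hirzebruch–Jung continued fraction `[x_1, …, x_k]⁻`,
defined recursively by `[x_k]⁻ = x_k` and `[x_1,…,x_k]⁻ = x_1 − 1/[x_2,…,x_k]⁻`. -/
noncomputable def hj : List ℝ → ℝ
  | [] => 0
  | [x] => x
  | x :: y :: l => x - 1 / hj (y :: l)

/-- The predicate asserting that the Hirzebruch–Jung continued fraction of a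
(nonempty) tuple is defined, i.e. no division by zero occurs in the recursion. -/
noncomputable def hjDef : List ℝ → Prop
  | [] => False
  | [_] => True
  | _ :: y :: l => hjDef (y :: l) ∧ hj (y :: l) ≠ 0

/-- `IsHJExp l p q` says that `l = (a_1, …, a_k)` is the Hirzebruch–Jung continued
fraction expansion of `p/q`: it is nonempty, all entries are integers `≥ 2`,
and `[a_1, …, a_k]⁻ = p/q`. -/
def IsHJExp (l : List ℤ) (p q : ℤ) : Prop :=
  l ≠ [] ∧ (∀ x ∈ l, 2 ≤ x) ∧ hj (l.map Int.cast) = (p : ℝ) / (q : ℝ)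

/-- `U([a_1,…,a_k]⁻) = Σ (a_i − 2)`. -/
def Ulist (l : List ℤ) : ℤ := (l.map (· - 2)).sum

/-- `V([a_1,…,a_k]⁻) = Σ (a_i − 1)`. -/
def Vlist (l : List ℤ) : ℤ := (l.map (· - 1)).sum

theorem hj_cons_of_ne_nil (x : ℝ) {l : List ℝ} (hl : l ≠ []) :
    hj (x :: l) = x - 1 / hj l := by
  cases l with
  | nil => exact absurd rfl hl
  | cons y l => rfl

theorem hj_sub_one_cons (x : ℝ) (l : List ℝ) : hj ((x - 1) :: l) = hj (x :: l) - 1 := by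
  cases l with
  | nil => rfl
  | cons y l => simp only [hj]; ring

theorem one_lt_hj {l : List ℤ} (hne : l ≠ []) (hl : ∀ x ∈ l, 2 ≤ x) :
    1 < hj (l.map Int.cast) := by
  induction l with
  | nil => exact absurd rfl hne
  | cons c t ih =>
    have hc : (2 : ℝ) ≤ c := by exact_mod_cast hl c (by simp)
    by_cases ht : t = []
    · subst ht
      simp only [List.map, hj]
      linarith
    · have h := ih ht fun x hx => hl x (by simp [hx])
      rw [List.map_cons, hj_cons_of_ne_nil _ (by simpa using ht)]
      have : 1 / hj (t.map Int.cast) < 1 := (div_lt_one (by linarith)).2 h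
      linarith

/-- The leading entry of an expansion is the ceiling of its value. -/
theorem sub_one_lt_hj_cons {c : ℤ} {t : List ℤ} (ht : ∀ x ∈ t, 2 ≤ x) :
    (c : ℝ) - 1 < hj ((c :: t).map Int.cast) := by
  by_cases hne : t = []
  · subst hne
    simp [hj]
  · have h := one_lt_hj hne ht
    rw [List.map_cons, hj_cons_of_ne_nil _ (by simpa using hne)]
    have : 1 / hj (t.map Int.cast) < 1 := (div_lt_one (by linarith)).2 h
    linarith

theorem hj_cons_lt {c : ℤ} {t : List ℤ} (hne : t ≠ []) (ht : ∀ x ∈ t, 2 ≤ x) :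
    hj ((c :: t).map Int.cast) < c := by
  have h := one_lt_hj hne ht
  rw [List.map_cons, hj_cons_of_ne_nil _ (by simpa using hne)]
  have : 0 < 1 / hj (t.map Int.cast) := by positivity
  linarith

theorem hj_cons_le {c : ℤ} {t : List ℤ} (ht : ∀ x ∈ t, 2 ≤ x) :
    hj ((c :: t).map Int.cast) ≤ c := by
  by_cases hne : t = []
  · subst hne
    simp [hj]
  · exact (hj_cons_lt hne ht).le

theorem eq_singleton_two_of_hj_eq_two {l : List ℤ} (hne : l ≠ []) (hl : ∀ x ∈ l, 2 ≤ x)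
    (h : hj (l.map Int.cast) = 2) : l = [2] := by
  obtain ⟨c, t, rfl⟩ := List.exists_cons_of_ne_nil hne
  have ht : ∀ x ∈ t, 2 ≤ x := fun x hx => hl x (by simp [hx])
  have h1 := sub_one_lt_hj_cons (c := c) ht
  rw [h] at h1
  have hc : c = 2 := by
    have : c < 3 := by
      have : (c : ℝ) < 3 := by linarith
      exact_mod_cast this
    have := hl c (by simp)
    omega
  by_cases hne' : t = []
  · rw [hc, hne']
  · have := hj_cons_lt (c := c) hne' ht
    rw [h, hc] at this
    norm_num at this

theorem Vlist_cons (c : ℤ) (t : List ℤ) : Vlist (c :: t) = c - 1 + Vlist t := by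
  simp [Vlist]

/-- Riemenschneider duality: expansions of `x` and `y` with `1/x + 1/y = 1` have total length
one more than either `V`-value. -/
theorem length_add_length_of_hj_dual {a b : List ℤ} (hane : a ≠ []) (hbne : b ≠ [])
    (ha : ∀ x ∈ a, 2 ≤ x) (hb : ∀ x ∈ b, 2 ≤ x)
    (h : hj (a.map Int.cast) * hj (b.map Int.cast)
      = hj (a.map Int.cast) + hj (b.map Int.cast)) :
    (a.length : ℤ) + b.length = Vlist a + 1 ∧ (a.length : ℤ) + b.length = Vlist b + 1 := by
  induction hn : a.length + b.length using Nat.strong_induction_on generalizing a b with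
  | _ n ih =>
  wlog hab : hj (a.map Int.cast) ≤ hj (b.map Int.cast) generalizing a b
  · have := this hbne hane hb ha (by linarith) (by omega) (le_of_not_ge hab)
    rw [add_comm (a.length : ℤ)]
    exact this.symm
  have hx1 := one_lt_hj hane ha
  have hy1 := one_lt_hj hbne hb
  have hx2 : hj (a.map Int.cast) ≤ 2 := by nlinarith
  rcases hx2.eq_or_lt with hx | hx
  · have hy : hj (b.map Int.cast) = 2 := by rw [hx] at h; linarith
    rw [eq_singleton_two_of_hj_eq_two hane ha hx, eq_singleton_two_of_hj_eq_two hbne hb hy]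
    simp [Vlist]
  have hy : 2 < hj (b.map Int.cast) := by nlinarith
  obtain ⟨c, s, rfl⟩ := List.exists_cons_of_ne_nil hane
  obtain ⟨d, t, rfl⟩ := List.exists_cons_of_ne_nil hbne
  have hs : ∀ x ∈ s, 2 ≤ x := fun x hx => ha x (by simp [hx])
  have ht : ∀ x ∈ t, 2 ≤ x := fun x hx => hb x (by simp [hx])
  have hc : c = 2 := by
    have h1 := sub_one_lt_hj_cons (c := c) hs
    have : c < 3 := by
      have : (c : ℝ) < 3 := by linarith
      exact_mod_cast this
    have := ha c (by simp)
    omega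
  subst hc
  have hd : 3 ≤ d := by
    have h1 := hj_cons_le (c := d) ht
    have : 2 < d := by
      have : (2 : ℝ) < d := by linarith
      exact_mod_cast this
    omega
  have hsne : s ≠ [] := by
    rintro rfl
    simp [hj] at hx
  have hs1 := one_lt_hj hsne hs
  have hb' : hj (((d - 1) :: t).map Int.cast) = hj ((d :: t).map Int.cast) - 1 := by
    simpa using hj_sub_one_cons (d : ℝ) (t.map Int.cast)
  have ha' : hj (((2 : ℤ) :: s).map Int.cast) = 2 - 1 / hj (s.map Int.cast) := by
    rw [List.map_cons, hj_cons_of_ne_nil _ (by simpa using hsne)]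
    norm_num
  have key := ih (s.length + ((d - 1) :: t).length) (by simp at hn ⊢; omega)
    hsne (List.cons_ne_nil (d - 1) t) hs
    (by
      intro x hx
      rcases List.mem_cons.1 hx with rfl | hx
      · omega
      · exact ht x hx)
    (by
      rw [hb']
      rw [ha'] at h
      have : hj (s.map Int.cast) ≠ 0 := by linarith
      field_simp at h
      linarith) rfl
  simp only [Vlist_cons, List.length_cons, Nat.cast_add, Nat.cast_one] at key ⊢
  omega

/-- If `p > q > 0` are relatively prime integers, then
`len(p/q) + len(p/(p−q)) = V(p/q) + 1`. -/
theorem stmt_8 (p q : ℤ) (hq : 0 < q) (hpq : q < p) (hco : IsCoprime p q)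
    (a b : List ℤ) (ha : IsHJExp a p q) (hb : IsHJExp b p (p - q)) :
    (a.length : ℤ) + (b.length : ℤ) = Vlist a + 1 := by
  have hp0 : (p : ℝ) ≠ 0 := by exact_mod_cast (by omega : p ≠ 0)
  have hq0 : (q : ℝ) ≠ 0 := by exact_mod_cast hq.ne'
  have hpq0 : (p : ℝ) - q ≠ 0 := by exact_mod_cast (by omega : p - q ≠ 0)
  refine (length_add_length_of_hj_dual ha.1 hb.1 ha.2.1 hb.2.1 ?_).1
  rw [ha.2.2, hb.2.2]
  push_cast
  field_simp
  ring
end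

section
/- Let p > q > 0 be relatively prime integers with V(p/q) = L. Then p = F_{L+2} if and only if p/q = F_{L+2}/F_L or p/q = F_{L+2}/F_{L+1}. -/
/-- Numerator and denominator of the Hirzebruch–Jung continued fraction of a list of integers. -/
def hjFrac : List ℤ → ℤ × ℤ
  | [] => (1, 0)
  | x :: l => (x * (hjFrac l).1 - (hjFrac l).2, (hjFrac l).1)

lemma hj_cons (x : ℝ) (l : List ℝ) : hj (x :: l) = x - 1 / hj l := by
  cases l <;> simp [hj]

lemma hjFrac_bounds {l : List ℤ} (h : ∀ x ∈ l, 2 ≤ x) :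
    0 ≤ (hjFrac l).2 ∧ (hjFrac l).2 < (hjFrac l).1 := by
  induction l with
  | nil => simp [hjFrac]
  | cons x l ih =>
    obtain ⟨h0, h1⟩ := ih fun y hy => h y (List.mem_cons_of_mem _ hy)
    have hx : 2 ≤ x := h x List.mem_cons_self
    simp only [hjFrac]
    constructor <;> nlinarith

lemma isCoprime_hjFrac (l : List ℤ) : IsCoprime (hjFrac l).1 (hjFrac l).2 := by
  induction l with
  | nil => exact isCoprime_one_left
  | cons x l ih =>
    obtain ⟨u, v, huv⟩ := ih
    refine ⟨-v, u + v * x, ?_⟩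
    simp only [hjFrac]
    linear_combination huv

lemma hj_eq_hjFrac {l : List ℤ} (h : ∀ x ∈ l, 2 ≤ x) :
    hj (l.map Int.cast) = ((hjFrac l).1 : ℝ) / ((hjFrac l).2 : ℝ) := by
  induction l with
  | nil => simp [hj, hjFrac]
  | cons x l ih =>
    have hl : ∀ y ∈ l, 2 ≤ y := fun y hy => h y (List.mem_cons_of_mem _ hy)
    obtain ⟨h0, h1⟩ := hjFrac_bounds hl
    have hn : ((hjFrac l).1 : ℝ) ≠ 0 := by exact_mod_cast (h0.trans_lt h1).ne'
    rw [List.map_cons, hj_cons, ih hl, one_div_div]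
    simp only [hjFrac]
    push_cast
    rw [sub_div, mul_div_cancel_right₀ _ hn]

/-- The pair `{q, p - q}` is bounded by the pair of Fibonacci numbers `{F_L, F_{L+1}}`. -/
def FibBounded (L : ℕ) (p q : ℤ) : Prop :=
  (q ≤ Nat.fib L ∧ p - q ≤ Nat.fib (L + 1)) ∨ (q ≤ Nat.fib (L + 1) ∧ p - q ≤ Nat.fib L)

lemma FibBounded.add {L : ℕ} {p q : ℤ} (h : FibBounded L p q) :
    FibBounded (L + 1) (p + q) q := by
  have h1 := Nat.fib_add_two (n := L)
  have h2 := Nat.fib_le_fib_succ (n := L)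
  unfold FibBounded at *
  rw [show L + 1 + 1 = L + 2 from rfl]
  omega

lemma FibBounded.two_mul_sub {L : ℕ} {p q : ℤ} (h : FibBounded L p q) :
    FibBounded (L + 1) (2 * p - q) p := by
  have h1 := Nat.fib_add_two (n := L)
  have h2 := Nat.fib_le_fib_succ (n := L)
  unfold FibBounded at *
  rw [show L + 1 + 1 = L + 2 from rfl]
  omega

lemma FibBounded.mul_sub {L : ℕ} {p q : ℤ} (h : FibBounded L p q) (k : ℕ) :
    FibBounded (L + k + 1) ((k + 2) * p - q) p := by
  induction k with
  | zero => simpa using h.two_mul_sub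
  | succ k ih =>
    convert ih.add using 1 <;> push_cast <;> ring

lemma exists_fibBounded_hjFrac {l : List ℤ} (h : ∀ x ∈ l, 2 ≤ x) :
    ∃ L : ℕ, (L : ℤ) = Vlist l ∧ FibBounded L (hjFrac l).1 (hjFrac l).2 := by
  induction l with
  | nil => exact ⟨0, by simp [Vlist], by simp [FibBounded, hjFrac]⟩
  | cons x l ih =>
    obtain ⟨L, hL, hb⟩ := ih fun y hy => h y (List.mem_cons_of_mem _ hy)
    obtain ⟨k, hk⟩ := Int.eq_ofNat_of_zero_le (sub_nonneg.2 (h x List.mem_cons_self))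
    obtain rfl : x = k + 2 := by omega
    refine ⟨L + k + 1, ?_, hb.mul_sub k⟩
    simp only [Vlist, List.map_cons, List.sum_cons] at hL ⊢
    push_cast
    linarith


/-- Let `p > q > 0` be relatively prime integers with `V(p/q) = L`. Then
`p = F_{L+2}` if and only if `p/q = F_{L+2}/F_L` or `p/q = F_{L+2}/F_{L+1}`. -/
theorem stmt_11 (p q : ℤ) (hq : 0 < q) (hpq : q < p) (hco : IsCoprime p q)
    (a : List ℤ) (ha : IsHJExp a p q) (L : ℕ) (hL : (L : ℤ) = Vlist a) :
    p = (Nat.fib (L + 2) : ℤ) ↔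
      ((p : ℚ) / (q : ℚ) = (Nat.fib (L + 2) : ℚ) / (Nat.fib L : ℚ) ∨
        (p : ℚ) / (q : ℚ) = (Nat.fib (L + 2) : ℚ) / (Nat.fib (L + 1) : ℚ)) := by
  obtain ⟨_, h2, hv⟩ := ha
  have eq_of_div_eq {m n : ℤ} (hmn : IsCoprime m n) (hn : 0 < n)
      (h : (p : ℚ) / q = m / n) : p = m ∧ q = n :=
    Rat.div_int_inj hq hn (Int.isCoprime_iff_nat_coprime.1 hco)
      (Int.isCoprime_iff_nat_coprime.1 hmn) h
  constructor
  · intro hp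
    obtain ⟨h0, h1⟩ := hjFrac_bounds h2
    rw [hj_eq_hjFrac h2] at hv
    have hd : 0 < (hjFrac a).2 := by
      refine h0.lt_of_ne fun h => ?_
      rw [← h, Int.cast_zero, div_zero] at hv
      have hp0 : (0 : ℝ) < p := by exact_mod_cast hq.trans hpq
      have hq0 : (0 : ℝ) < q := by exact_mod_cast hq
      exact (div_pos hp0 hq0).ne hv
    obtain ⟨hp', hq'⟩ := eq_of_div_eq (isCoprime_hjFrac a) hd (by exact_mod_cast hv.symm)
    obtain ⟨M, hM, hb⟩ := exists_fibBounded_hjFrac h2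
    obtain rfl : L = M := by omega
    rw [← hp', ← hq'] at hb
    have hfib := Nat.fib_add_two (n := L)
    have hcases : q = Nat.fib L ∨ q = Nat.fib (L + 1) := by
      unfold FibBounded at hb
      omega
    rw [hp]
    rcases hcases with h | h
    · left
      simp [h]
    · right
      simp [h]
  · have hfib := Nat.isCoprime_iff_coprime.2 (Nat.fib_coprime_fib_succ (L + 1)).symm
    rintro (h | h)
    · have hL0 : 0 < Nat.fib L := by
        refine Nat.pos_of_ne_zero fun h0 => ?_
        rw [h0, Nat.cast_zero, div_zero] at h
        have hp0 : (0 : ℚ) < p := by exact_mod_cast hq.trans hpq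
        have hq0 : (0 : ℚ) < q := by exact_mod_cast hq
        exact (div_pos hp0 hq0).ne' h
      have hco' : Nat.Coprime (Nat.fib (L + 2)) (Nat.fib L) := by
        rw [Nat.fib_add_two]
        simpa using (Nat.fib_coprime_fib_succ L).symm
      exact (eq_of_div_eq (Nat.isCoprime_iff_coprime.2 hco') (by exact_mod_cast hL0)
        (by push_cast; exact h)).1
    · exact (eq_of_div_eq hfib (by exact_mod_cast Nat.fib_pos.2 L.succ_pos)
        (by push_cast; exact h)).1
end
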